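/- arXiv:2406.11688 — 2 statements merged into one kernel-verified Lean document; each statement's English description precedes it below -/
import Mathlib

section
/- Let k ≥ 1 be an integer and G a finite simple graph. Then i_[kR](G) = (k+1)·i(G) (i.e., G is independent [k]-Roman) if and only if there exists an independent [k]-Roman dominating function f of G of minimum weight i_[kR](G) such that no vertex of G receives label k under f. -/
/-!
Basic definitions for `[k]`-Roman domination on (finite) simple graphs.
-/

namespace KRoman

variable {V : Type*}

/-- `|AN(v)|`: the number of active neighbors of `v` under `f`. -/
noncomputable def activeNbrCard (G : SimpleGraph V) (f : V → ℕ) (v : V) : ℕ :=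
  {u | G.Adj v u ∧ 1 ≤ f u}.ncard

/-- `Σ_{u ∈ N[v]} f(u)`: the sum of `f` over the closed neighborhood of `v`. -/
noncomputable def closedNbhdSum (G : SimpleGraph V) (f : V → ℕ) (v : V) : ℕ :=
  f v + ∑ᶠ u ∈ {u | G.Adj v u}, f u

/-- `f` is a `[k]`-Roman dominating function on `G`. -/
def IsKRDF (G : SimpleGraph V) (k : ℕ) (f : V → ℕ) : Prop :=
  (∀ v, f v ≤ k + 1) ∧
  ∀ v, f v < k → k + activeNbrCard G f v ≤ closedNbhdSum G f v

/-- `f` is an independent `[k]`-Roman dominating function on `G`: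
a `[k]`-RDF whose set of active vertices is independent. -/
def IsKIRDF (G : SimpleGraph V) (k : ℕ) (f : V → ℕ) : Prop :=
  IsKRDF G k f ∧ ∀ u v, G.Adj u v → ¬(1 ≤ f u ∧ 1 ≤ f v)

/-- The weight `ω(f) = Σ_v f(v)` of a labeling. -/
noncomputable def weight (f : V → ℕ) : ℕ := ∑ᶠ v, f v

/-- The `[k]`-Roman domination number `γ_[kR](G)`. -/
noncomputable def gammaKR (G : SimpleGraph V) (k : ℕ) : ℕ :=
  sInf {w | ∃ f : V → ℕ, IsKRDF G k f ∧ weight f = w}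

/-- The independent `[k]`-Roman domination number `i_[kR](G)`. -/
noncomputable def iKR (G : SimpleGraph V) (k : ℕ) : ℕ :=
  sInf {w | ∃ f : V → ℕ, IsKIRDF G k f ∧ weight f = w}

/-- The degree of a vertex. -/
noncomputable def deg (G : SimpleGraph V) (v : V) : ℕ := {u | G.Adj v u}.ncard


/-- `S` is an independent dominating set of `G`. -/
def IsIndepDomSet (G : SimpleGraph V) (S : Set V) : Prop :=
  (∀ u ∈ S, ∀ v ∈ S, ¬ G.Adj u v) ∧ ∀ v, v ∉ S → ∃ u ∈ S, G.Adj u v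

/-- The independent domination number `i(G)`. -/
noncomputable def indepDom (G : SimpleGraph V) : ℕ :=
  sInf {n | ∃ S : Set V, IsIndepDomSet G S ∧ S.ncard = n}

open Classical in
theorem finsum_ite_const {V : Type*} [Finite V] (S : Set V) (c : ℕ) :
    (∑ᶠ v, if v ∈ S then c else 0) = c * S.ncard := by
  have := Fintype.ofFinite V
  rw [finsum_eq_sum_of_fintype, ← Finset.sum_filter, Finset.sum_const, smul_eq_mul, mul_comm,
    Set.ncard_eq_toFinset_card']
  congr 2
  ext v
  simp

open Classical in
theorem isKIRDF_of_indepDom {V : Type*} [Finite V] (G : SimpleGraph V) (k : ℕ)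
    (S : Set V) (hS : IsIndepDomSet G S) :
    IsKIRDF G k (fun v => if v ∈ S then k + 1 else 0) := by
  refine ⟨⟨fun v => ?_, fun v hv => ?_⟩, fun u v huv h => ?_⟩
  · dsimp only
    split_ifs <;> omega
  · have hvS : v ∉ S := by
      intro h
      simp only [h, if_true] at hv
      omega
    have hset : {u | G.Adj v u ∧ 1 ≤ (if u ∈ S then k + 1 else 0)}
        = {u | G.Adj v u ∧ u ∈ S} := by
      ext u
      by_cases hu : u ∈ S <;> simp [hu]
    have hsum : (∑ᶠ u ∈ {u | G.Adj v u}, if u ∈ S then k + 1 else 0)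
        = (k + 1) * {u | G.Adj v u ∧ u ∈ S}.ncard := by
      rw [← finsum_ite_const]
      refine finsum_congr fun u => ?_
      by_cases hu : G.Adj v u <;> simp [hu]
    have hpos : 1 ≤ {u | G.Adj v u ∧ u ∈ S}.ncard := by
      obtain ⟨u, hu, hadj⟩ := hS.2 v hvS
      exact (Set.ncard_pos (Set.toFinite _)).2 ⟨u, hadj.symm, hu⟩
    unfold activeNbrCard closedNbhdSum
    rw [hset, hsum]
    have h2 := Nat.mul_le_mul_left k hpos
    rw [add_mul]
    omega
  · have hu : u ∈ S := by
      by_contra hn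
      simp [hn] at h
    have hv : v ∈ S := by
      by_contra hn
      simp [hn] at h
    exact hS.1 u hu v hv huv

theorem exists_indepDom {V : Type*} [Finite V] (G : SimpleGraph V) :
    ∃ S : Set V, IsIndepDomSet G S := by
  obtain ⟨S, hS⟩ := (Set.toFinite {S : Set V | ∀ u ∈ S, ∀ v ∈ S, ¬ G.Adj u v}).exists_maximal
    ⟨∅, by simp⟩
  refine ⟨S, hS.1, fun v hv => ?_⟩
  by_contra! hn
  apply hv
  refine hS.2 (y := insert v S) ?_ (Set.subset_insert v S) (Set.mem_insert v S)
  rintro a (rfl | ha) b (rfl | hb) hab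
  · exact G.loopless.irrefl _ hab
  · exact hn b hb hab.symm
  · exact hn a ha hab
  · exact hS.1 a ha b hb hab

theorem exists_min_indepDom {V : Type*} [Finite V] (G : SimpleGraph V) :
    ∃ S : Set V, IsIndepDomSet G S ∧ S.ncard = indepDom G := by
  obtain ⟨S, hS⟩ := exists_indepDom G
  exact Nat.sInf_mem (s := {n | ∃ S : Set V, IsIndepDomSet G S ∧ S.ncard = n}) ⟨_, S, hS, rfl⟩

theorem adj_zero_sum {V : Type*} (G : SimpleGraph V) (f : V → ℕ) (v : V)
    (h : ∀ u, G.Adj v u → f u = 0) : closedNbhdSum G f v = f v := by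
  unfold closedNbhdSum
  have h0 : (∑ᶠ u ∈ {u | G.Adj v u}, f u) = 0 :=
    finsum_mem_eq_zero_of_forall_eq_zero (fun u hu => h u hu)
  rw [h0, add_zero]

/-- `G` is independent `[k]`-Roman, i.e. `i_[kR](G) = (k+1)·i(G)`, iff `G`
admits an independent `[k]`-Roman dominating function of minimum weight `i_[kR](G)` assigning
the label `k` to no vertex. -/
theorem independent_kRoman_iff {V : Type*} [Finite V] (G : SimpleGraph V) (k : ℕ)
    (hk : 1 ≤ k) :
    iKR G k = (k + 1) * indepDom G ↔
      ∃ f : V → ℕ, IsKIRDF G k f ∧ weight f = iKR G k ∧ ∀ v, f v ≠ k := by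
  classical
  obtain ⟨S, hS, hcard⟩ := exists_min_indepDom G
  have hg := isKIRDF_of_indepDom G k S hS
  have hw : weight (fun v => if v ∈ S then k + 1 else 0) = (k + 1) * indepDom G := by
    rw [← hcard, ← finsum_ite_const S (k + 1)]
    exact finsum_congr fun u => by congr
  constructor
  · intro h
    refine ⟨_, hg, ?_, fun v => ?_⟩
    · rw [h, ← hw]
    · split_ifs <;> omega
  · rintro ⟨f, hf, hfw, hfk⟩
    apply le_antisymm
    · refine Nat.sInf_le ⟨_, hg, ?_⟩
      rw [← hw]
    · have hval : ∀ v, 1 ≤ f v → f v = k + 1 := by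
        intro v hv
        by_contra hne
        have h1 := hf.1.1 v
        have h2 := hfk v
        have h3 := hf.1.2 v (by omega)
        rw [adj_zero_sum G f v (fun u hu => by
          have := hf.2 v u hu
          omega)] at h3
        omega
      have hT : IsIndepDomSet G {v | 1 ≤ f v} := by
        refine ⟨fun u hu v hv huv => hf.2 u v huv ⟨hu, hv⟩, fun v hv => ?_⟩
        by_contra! hn
        have hv0 : f v = 0 := by
          simp only [Set.mem_ofPred_eq] at hv
          omega
        have h3 := hf.1.2 v (by omega)
        rw [adj_zero_sum G f v (fun u hu => by
          by_contra h0
          exact hn u (Nat.one_le_iff_ne_zero.2 h0) hu.symm)] at h3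
        omega
      have hle : indepDom G ≤ {v | 1 ≤ f v}.ncard := Nat.sInf_le ⟨_, hT, rfl⟩
      have hwf : weight f = (k + 1) * {v | 1 ≤ f v}.ncard := by
        rw [← finsum_ite_const]
        refine finsum_congr fun v => ?_
        by_cases hv : 1 ≤ f v
        · simp [hval v hv]
        · simp only [Set.mem_ofPred_eq, hv, if_false]
          omega
      rw [← hfw, hwf]
      exact Nat.mul_le_mul_left _ hle
end KRoman
end

section
/- Let k ≥ 1 be an integer and let G be a connected finite simple graph with at least 2 vertices whose maximum degree satisfies Δ(G) ≥ 3. Then i_[kR](G) ≥ |V(G)|·(k+1) / (Δ(G)+1). -/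
/-!
Basic definitions for `[k]`-Roman domination on (finite) simple graphs.
-/

namespace KRoman

variable {V : Type*}

/-- The maximum degree `Δ(G)`. -/
noncomputable def maxDeg (G : SimpleGraph V) : ℕ := sSup {d | ∃ v, deg G v = d}

section Helpers

open Classical in
lemma closedNbhdSum_eq [Fintype V] (G : SimpleGraph V) (f : V → ℕ) (v : V) :
    closedNbhdSum G f v = f v + ∑ u, if G.Adj v u then f u else 0 := by
  unfold closedNbhdSum
  rw [finsum_mem_def, finsum_eq_sum_of_fintype]
  simp [Set.indicator_apply]

open Classical in
lemma activeNbrCard_eq [Fintype V] (G : SimpleGraph V) (f : V → ℕ) (v : V) :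
    activeNbrCard G f v = ∑ u, if G.Adj v u then (if 1 ≤ f u then 1 else 0) else 0 := by
  unfold activeNbrCard
  rw [Set.ncard_eq_toFinset_card']
  simp only [← ite_and, Finset.sum_boole, Nat.cast_id]
  congr 1
  ext; simp

open Classical in
lemma deg_eq [Fintype V] (G : SimpleGraph V) (v : V) :
    deg G v = ∑ u, if G.Adj v u then 1 else 0 := by
  unfold deg
  rw [Set.ncard_eq_toFinset_card']
  simp only [Finset.sum_boole, Nat.cast_id]
  congr 1
  ext; simp

lemma deg_le_maxDeg [Finite V] (G : SimpleGraph V) (v : V) : deg G v ≤ maxDeg G := by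
  unfold maxDeg
  apply le_csSup
  · exact (Set.finite_range (deg G)).bddAbove
  · exact ⟨v, rfl⟩

lemma arith (k p q : ℕ) (hk : 1 ≤ k) (h : k + (p + q) ≤ k * p + (k + 1) * q) :
    2 * (k + 1) + p ≤ 2 * (k * p + (k + 1) * q) := by
  rcases Nat.eq_zero_or_pos q with rfl | hq
  · obtain ⟨j, rfl⟩ := Nat.exists_eq_add_of_le hk
    have hp : 2 ≤ p := by
      by_contra hp
      have : p = 0 ∨ p = 1 := by omega
      rcases this with rfl | rfl <;> omega
    have hj : 1 ≤ j := by
      by_contra hj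
      have : j = 0 := by omega
      subst this
      omega
    nlinarith [Nat.mul_le_mul hp hj]
  · nlinarith [Nat.mul_le_mul hk (le_refl p), Nat.mul_le_mul (le_refl (k + 1)) hq]

open Classical in
lemma sum_swap [Fintype V] (G : SimpleGraph V) (g : V → ℕ) :
    ∑ v, ∑ u, (if G.Adj v u then g u else 0) = ∑ u, g u * deg G u := by
  rw [Finset.sum_comm]
  refine Finset.sum_congr rfl fun u _ => ?_
  rw [deg_eq, Finset.mul_sum]
  refine Finset.sum_congr rfl fun v _ => ?_
  simp [G.adj_comm u v]

lemma exists_KIRDF [Finite V] (G : SimpleGraph V) (k : ℕ) : ∃ f, IsKIRDF G k f := by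
  classical
  have := Fintype.ofFinite V
  obtain ⟨S, hS⟩ := (Set.toFinite {S : Set V | ∀ u ∈ S, ∀ v ∈ S, ¬ G.Adj u v}).exists_maximal
    ⟨∅, by simp⟩
  have hind : ∀ u ∈ S, ∀ v ∈ S, ¬ G.Adj u v := hS.prop
  have hdom : ∀ v, v ∉ S → ∃ u ∈ S, G.Adj v u := by
    intro v hv
    by_contra! hno
    have h1 : insert v S ∈ {S : Set V | ∀ u ∈ S, ∀ v ∈ S, ¬ G.Adj u v} := by
      rintro a (rfl | ha) b (rfl | hb)
      · exact G.irrefl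
      · exact hno b hb
      · exact fun h => hno a ha h.symm
      · exact hind a ha b hb
    exact hv (hS.le_of_ge h1 (Set.subset_insert v S) (Set.mem_insert v S))
  refine ⟨fun v => if v ∈ S then k + 1 else 0, ⟨fun v => ?_, fun v hv => ?_⟩, ?_⟩
  · dsimp only; split_ifs <;> omega
  · have hvS : v ∉ S := by
      intro h; simp [h] at hv
    obtain ⟨w, hw, hvw⟩ := hdom v hvS
    rw [closedNbhdSum_eq, activeNbrCard_eq]
    have e : k = ∑ u : V, if u = w then k else 0 := by simp
    refine le_trans ?_ (Nat.le_add_left _ _)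
    conv_lhs => rw [e]
    rw [← Finset.sum_add_distrib]
    refine Finset.sum_le_sum fun u _ => ?_
    by_cases h : u = w
    · subst h; simp [hw, hvw]
    · by_cases h2 : u ∈ S <;> simp [h, h2]
      split_ifs <;> omega
  · rintro u v huv ⟨h1, h2⟩
    have hu : u ∈ S := by by_contra h; simp [h] at h1
    have hv : v ∈ S := by by_contra h; simp [h] at h2
    exact hind u hu v hv huv

lemma main_bound [Finite V] (G : SimpleGraph V) (k : ℕ) (hk : 1 ≤ k) (hD : 3 ≤ maxDeg G)
    (f : V → ℕ) (hf : IsKIRDF G k f) :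
    Nat.card V * (k + 1) ≤ weight f * (maxDeg G + 1) := by
  classical
  have := Fintype.ofFinite V
  obtain ⟨⟨hle, hdom⟩, hind⟩ := hf
  have hnb : ∀ v, 1 ≤ f v → ∀ u, G.Adj v u → f u = 0 := by
    intro v hv u h
    have := hind v u h
    omega
  have hact : ∀ v, 1 ≤ f v → f v = k ∨ f v = k + 1 := by
    intro v hv
    by_contra hne
    have hl := hle v
    have h := hdom v (by omega)
    have hz : (∑ u, if G.Adj v u then f u else 0) = 0 := by
      refine Finset.sum_eq_zero fun u _ => ?_
      split_ifs with h
      · exact hnb v hv u h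
      · rfl
    rw [closedNbhdSum_eq, hz] at h
    omega
  let a : V → ℕ := fun v => if f v = k then 1 else 0
  let b : V → ℕ := fun v => if f v = k + 1 then 1 else 0
  have hfab : ∀ v, f v = k * a v + (k + 1) * b v := by
    intro v
    rcases Nat.eq_zero_or_pos (f v) with h | h
    · have : ¬ (0 = k) := by omega
      simp [a, b, h, this]
    · rcases hact v h with h | h <;> simp [a, b, h]
  have h1ab : ∀ v, (if 1 ≤ f v then 1 else 0) = a v + b v := by
    intro v
    rcases Nat.eq_zero_or_pos (f v) with h | h
    · have : ¬ (0 = k) := by omega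
      simp [a, b, h, this]
    · rcases hact v h with h | h <;> simp [a, b, h, hk]
  have key : ∀ v, 2 * (k + 1) + (∑ u, if G.Adj v u then a u else 0) ≤
      2 * (f v + ∑ u, if G.Adj v u then f u else 0) + 2 * a v := by
    intro v
    rcases Nat.eq_zero_or_pos (f v) with h | h
    · have hd := hdom v (by omega)
      have e1 : (∑ u, if G.Adj v u then f u else 0) =
          k * (∑ u, if G.Adj v u then a u else 0) +
            (k + 1) * (∑ u, if G.Adj v u then b u else 0) := by
        rw [Finset.mul_sum, Finset.mul_sum, ← Finset.sum_add_distrib]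
        refine Finset.sum_congr rfl fun u _ => ?_
        split_ifs
        · exact hfab u
        · simp
      have e2 : activeNbrCard G f v = (∑ u, if G.Adj v u then a u else 0) +
            (∑ u, if G.Adj v u then b u else 0) := by
        rw [activeNbrCard_eq, ← Finset.sum_add_distrib]
        refine Finset.sum_congr rfl fun u _ => ?_
        by_cases hu : G.Adj v u
        · simp only [hu, if_true]; exact h1ab u
        · simp [hu]
      rw [closedNbhdSum_eq, e1, e2, h, zero_add] at hd
      rw [e1, h, zero_add]
      have := arith k _ _ hk hd
      omega
    · have hz : (∑ u, if G.Adj v u then a u else 0) = 0 := by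
        refine Finset.sum_eq_zero fun u _ => ?_
        split_ifs with hu
        · have h0 := hnb v h u hu
          have : ¬ (0 = k) := by omega
          simp [a, h0, this]
        · rfl
      rw [hz]
      rcases hact v h with h | h
      · have : a v = 1 := by simp [a, h]
        omega
      · omega
  have hsum := Finset.sum_le_sum fun v (_ : v ∈ Finset.univ) => key v
  simp only [Finset.sum_add_distrib, ← Finset.mul_sum, sum_swap] at hsum
  have hpt : ∀ v, 2 * (f v + f v * deg G v) + 2 * a v ≤
      2 * (f v * (maxDeg G + 1)) + a v * deg G v := by
    intro v
    have hd := deg_le_maxDeg G v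
    by_cases h : f v = k
    · have ha : a v = 1 := by simp [a, h]
      rw [ha, h]
      rcases hd.eq_or_lt with hd | hd
      · rw [hd]; nlinarith
      · nlinarith [Nat.mul_le_mul (le_refl k) (Nat.succ_le_of_lt hd)]
    · have ha : a v = 0 := by simp [a, h]
      rw [ha]
      nlinarith [Nat.mul_le_mul (le_refl (f v)) hd]
  have hsum2 := Finset.sum_le_sum fun v (_ : v ∈ Finset.univ) => hpt v
  simp only [Finset.sum_add_distrib, ← Finset.mul_sum, ← Finset.sum_mul] at hsum2
  have hw : weight f = ∑ v, f v := finsum_eq_sum_of_fintype f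
  have hc : ∑ v : V, 2 * (k + 1) = 2 * (Nat.card V * (k + 1)) := by
    simp; ring
  simp only [Finset.sum_const, Finset.card_univ, smul_eq_mul] at hsum hc
  rw [hw]
  rw [Nat.card_eq_fintype_card] at *
  nlinarith

end Helpers

/-- For `k ≥ 1` and a nontrivial connected graph `G` with `Δ(G) ≥ 3`,
`i_[kR](G) ≥ |V(G)|·(k+1)/(Δ(G)+1)`. -/
theorem iKR_lower_bound_of_maxDeg_ge_three {V : Type*} [Finite V] (G : SimpleGraph V)
    (k : ℕ) (hk : 1 ≤ k) (hconn : G.Connected) (hcard : 2 ≤ Nat.card V)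
    (hΔ : 3 ≤ maxDeg G) :
    ((Nat.card V : ℝ) * (k + 1)) / ((maxDeg G : ℝ) + 1) ≤ (iKR G k : ℝ) := by
  have hmem : iKR G k ∈ {w | ∃ f : V → ℕ, IsKIRDF G k f ∧ weight f = w} := by
    obtain ⟨f, hf⟩ := exists_KIRDF G k
    exact Nat.sInf_mem ⟨_, f, hf, rfl⟩
  obtain ⟨f, hf, hw⟩ := hmem
  have h := main_bound G k hk hΔ f hf
  rw [hw] at h
  rw [div_le_iff₀ (by positivity)]
  exact_mod_cast h
end KRoman
end
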